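/- Let k be an algebraically closed field of characteristic zero and A a finite-dimensional self-injective k-algebra. Let (S_i)_{i∈I} be a complete set of representatives of the isomorphism classes of simple left A-modules with projective covers (P_i)_{i∈I}, and let c_{ij} = dim_k Hom_A(P_i, P_j) be the Cartan matrix of A. Then for all a, b ∈ A, the trace of the k-linear map A → A, x ↦ a x b, equals Σ_{i,j∈I} c_{ij} · χ^A_{S_i}(a) · χ^A_{S_j}(b). -/

import Mathlib

/-- The character of a finite-dimensional module `M` over a finite-dimensional `k`-algebra `A`:
it sends `a : A` to the trace of the `k`-linear map `m ↦ a • m` on `M`. -/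
noncomputable def moduleChar (k : Type*) [Field k] {A : Type*} [Ring A] [Algebra k A]
    (M : Type*) [AddCommGroup M] [Module k M] [Module A M] [IsScalarTower k A M]
    (a : A) : k :=
  LinearMap.trace k M (DistribMulAction.toLinearMap k M a)

universe u v

/-- A linear functional on `End k V` vanishing on commutators is a multiple of the trace. -/
theorem aux_trace_unique {k : Type*} [Field k] {V : Type*} [AddCommGroup V] [Module k V]
    [FiniteDimensional k V] (φ : Module.End k V →ₗ[k] k)
    (hφ : ∀ x y, φ (x * y) = φ (y * x)) :
    ∃ c : k, ∀ x, φ x = c * LinearMap.trace k V x := by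
  classical
  let bs := Module.finBasis k V
  have hx : ∀ x : Module.End k V, x = ∑ i, (bs.coord i).smulRight (x (bs i)) := by
    intro x
    ext v
    conv_lhs => rw [← bs.sum_repr v]
    rw [map_sum]
    simp
  by_cases hn : ∃ i : Fin (Module.finrank k V), True
  · obtain ⟨i0, -⟩ := hn
    have key : ∀ (g : V →ₗ[k] k) (v : V),
        φ (g.smulRight v) = g v * φ ((bs.coord i0).smulRight (bs i0)) := by
      intro g v
      have h := hφ ((bs.coord i0).smulRight v) (g.smulRight (bs i0))
      have e1 : ((bs.coord i0).smulRight v : Module.End k V) * (g.smulRight (bs i0))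
          = g.smulRight v := by
        ext w; simp
      have e2 : (g.smulRight (bs i0) : Module.End k V) * ((bs.coord i0).smulRight v)
          = g v • (bs.coord i0).smulRight (bs i0) := by
        ext w; simp [smul_smul, mul_comm]
      rw [e1, e2, map_smul, smul_eq_mul] at h
      exact h
    refine ⟨φ ((bs.coord i0).smulRight (bs i0)), fun x => ?_⟩
    rw [hx x, map_sum, map_sum, Finset.mul_sum]
    refine Finset.sum_congr rfl fun i _ => ?_
    rw [key, LinearMap.trace_smulRight, mul_comm]
  · refine ⟨0, fun x => ?_⟩
    rw [hx x, Finset.sum_eq_zero]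
    · simp
    · intro i _
      exact absurd ⟨i, trivial⟩ hn

/-- Density: the algebra surjects onto the product of the endomorphism rings of the simples. -/
theorem aux_density {k : Type*} [Field k] [IsAlgClosed k] {A : Type*} [Ring A] [Algebra k A]
    {I : Type*} [Fintype I]
    (S : I → Type*) [∀ i, AddCommGroup (S i)] [∀ i, Module k (S i)] [∀ i, Module A (S i)]
    [∀ i, IsScalarTower k A (S i)] [∀ i, FiniteDimensional k (S i)]
    (hsimple : ∀ i, IsSimpleModule A (S i))
    (hdistinct : ∀ i i', Nonempty (S i ≃ₗ[A] S i') → i = i')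
    (g : ∀ i, Module.End k (S i)) :
    ∃ a : A, ∀ i (m : S i), a • m = g i m := by
  classical
  have hs := hsimple
  have hc : ∀ (h : Module.End A (∀ i, S i)) (i : I), ∃ c : k, ∀ m, h m i = c • m i := by
    intro h i
    obtain ⟨c, hc⟩ := (IsSimpleModule.algebraMap_end_bijective_of_isAlgClosed (A := A)
      (V := S i) k).2 (LinearMap.proj i ∘ₗ h ∘ₗ LinearMap.single A S i)
    refine ⟨c, fun m => ?_⟩
    have hm : m = ∑ j, LinearMap.single A S j (m j) := by
      simp [Finset.univ_sum_single]
    conv_lhs => rw [hm]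
    rw [map_sum, Finset.sum_apply, Finset.sum_eq_single i]
    · have := congrArg (fun t => t (m i)) hc
      simp at this
      simp [this]
    · intro j _ hj
      rcases (LinearMap.proj i ∘ₗ h ∘ₗ LinearMap.single A S j : S j →ₗ[A] S i).bijective_or_eq_zero
        with hb | hb
      · exact absurd (hdistinct _ _ ⟨LinearEquiv.ofBijective _ hb⟩) hj
      · exact congrArg (fun t => t (m j)) hb
    · simp
  let F : Module.End (Module.End A (∀ i, S i)) (∀ i, S i) :=
    { toFun := fun m i => g i (m i)
      map_add' := fun x y => by ext i; simp
      map_smul' := fun h m => by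
        ext i
        obtain ⟨c, hc⟩ := hc h i
        simp [hc] }
  obtain ⟨s, hs'⟩ := (inferInstance : Module.Finite k (∀ i, S i))
  obtain ⟨a, ha⟩ := jacobson_density F s
  refine ⟨a, fun i m => ?_⟩
  have key : ∀ m : (∀ i, S i), F m = a • m := by
    intro m
    have hm : m ∈ Submodule.span k (s : Set (∀ i, S i)) := hs' ▸ Submodule.mem_top
    induction hm using Submodule.span_induction with
    | mem m hm => exact ha m hm
    | zero => simp
    | add x y _ _ hx hy => rw [map_add, hx, hy, smul_add]
    | smul c x _ hx =>
      have : F (c • x) = c • F x := by ext i; simp [F]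
      rw [this, hx, smul_comm]
  have := congrFun (key (Pi.single i m)) i
  simpa [F] using this.symm

/-- An element killing every simple module is nilpotent. -/
theorem aux_nilp {k : Type*} [Field k] {A : Type v} [Ring A] [Algebra k A]
    [FiniteDimensional k A] (a : A)
    (h : ∀ (U : Type v) [AddCommGroup U] [Module A U], IsSimpleModule A U → ∀ u : U, a • u = 0) :
    IsNilpotent a := by
  have : IsArtinianRing A := IsArtinianRing.of_finite k A
  have hJ : a ∈ Ring.jacobson A := by
    rw [Ring.jacobson, Module.jacobson, Submodule.mem_sInf]
    intro m hm
    have := h (A ⧸ m) (isSimpleModule_iff_isCoatom.mpr hm) (Submodule.Quotient.mk 1)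
    rw [← Submodule.Quotient.mk_smul, Submodule.Quotient.mk_eq_zero] at this
    simpa using this
  obtain ⟨n, hn⟩ := IsSemiprimaryRing.isNilpotent (R := A)
  refine ⟨n, ?_⟩
  have := Ideal.pow_mem_pow hJ n
  rw [hn] at this
  simpa using this

/-- `tr (e | M) = dim Hom(P, M)` for `P ≅ A e`. -/
theorem aux_trace_hom {k : Type*} [Field k] {A : Type*} [Ring A] [Algebra k A]
    {P : Type*} [AddCommGroup P] [Module A P]
    (s : P →ₗ[A] A) (p : P) (hs : ∀ q, s q • p = q)
    (M : Type*) [AddCommGroup M] [Module k M] [Module A M] [IsScalarTower k A M]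
    [FiniteDimensional k M] :
    moduleChar k M (s p) = (Module.finrank k (P →ₗ[A] M) : k) := by
  let T : M →ₗ[k] M := DistribMulAction.toLinearMap k M (s p)
  have hTx : ∀ x, T x = s p • x := fun _ => rfl
  have he : s p * s p = s p := by
    rw [← smul_eq_mul, ← map_smul, hs]
  have hT : LinearMap.IsProj (LinearMap.range T) T :=
    ⟨fun x => ⟨x, rfl⟩, by
      rintro _ ⟨x, rfl⟩
      simp [hTx, smul_smul, he]⟩
  have e : (P →ₗ[A] M) ≃ₗ[k] LinearMap.range T :=
    { toFun := fun h => ⟨h p, h p, by simp [hTx, ← map_smul, hs]⟩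
      map_add' := fun x y => by ext; simp
      map_smul' := fun c x => by ext; simp
      invFun := fun m => (LinearMap.toSpanSingleton A M m.1) ∘ₗ s
      left_inv := fun h => by
        ext q
        simp [← map_smul, hs]
      right_inv := by
        rintro ⟨_, ⟨x, rfl⟩⟩
        ext
        simp [hTx, smul_smul, he] }
  rw [e.finrank_eq]
  exact hT.trace

/-- A functional vanishing on commutators and nilpotents is a combination of characters. -/
theorem aux_class {k : Type u} [Field k] [IsAlgClosed k] {A : Type v} [Ring A] [Algebra k A]
    [FiniteDimensional k A]
    {I : Type v} [Fintype I]
    (S : I → Type v) [∀ i, AddCommGroup (S i)] [∀ i, Module k (S i)] [∀ i, Module A (S i)]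
    [∀ i, IsScalarTower k A (S i)] [∀ i, FiniteDimensional k (S i)]
    (hsimple : ∀ i, IsSimpleModule A (S i))
    (hdistinct : ∀ i i', Nonempty (S i ≃ₗ[A] S i') → i = i')
    (hcomplete : ∀ (U : Type v) [AddCommGroup U] [Module A U],
      IsSimpleModule A U → ∃ i, Nonempty (U ≃ₗ[A] S i))
    (φ : A →ₗ[k] k) (hφ : ∀ x y, φ (x * y) = φ (y * x)) (hnil : ∀ x, IsNilpotent x → φ x = 0) :
    ∃ c : I → k, ∀ x, φ x = ∑ i, c i * moduleChar k (S i) x := by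
  classical
  let ρ : A →ₗ[k] (∀ i, Module.End k (S i)) :=
    { toFun := fun a i => DistribMulAction.toLinearMap k (S i) a
      map_add' := fun x y => by
        ext i m
        exact add_smul x y m
      map_smul' := fun c x => by
        ext i m
        exact smul_assoc c x m }
  have hρ : ∀ a i (m : S i), ρ a i m = a • m := fun _ _ _ => rfl
  have hρm : ∀ a b, ρ (a * b) = ρ a * ρ b := by
    intro a b
    ext i m
    simp [hρ, mul_smul]
  have hρs : Function.Surjective ρ := by
    intro g
    obtain ⟨a, ha⟩ := aux_density (A := A) S hsimple hdistinct g
    exact ⟨a, by ext i m; exact ha i m⟩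
  have hker : LinearMap.ker ρ ≤ LinearMap.ker φ := by
    intro a ha
    refine hnil a (aux_nilp (k := k) a fun U _ _ hU u => ?_)
    obtain ⟨i, ⟨e⟩⟩ := hcomplete U hU
    apply e.injective
    rw [map_smul, map_zero, ← hρ, LinearMap.mem_ker.mp ha]
    rfl
  obtain ⟨ψ, hψ⟩ : ∃ ψ : (∀ i, Module.End k (S i)) →ₗ[k] k, ∀ a, ψ (ρ a) = φ a := by
    refine ⟨(LinearMap.ker ρ).liftQ φ hker ∘ₗ
      (ρ.quotKerEquivOfSurjective hρs).symm.toLinearMap, fun a => ?_⟩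
    have : (ρ.quotKerEquivOfSurjective hρs).symm (ρ a) = Submodule.Quotient.mk a := by
      rw [LinearEquiv.symm_apply_eq]
      rfl
    simp [this]
  have hψc : ∀ x y, ψ (x * y) = ψ (y * x) := by
    intro x y
    obtain ⟨a, rfl⟩ := hρs x
    obtain ⟨b, rfl⟩ := hρs y
    rw [← hρm, ← hρm, hψ, hψ, hφ]
  have hex : ∀ i, ∃ c : k, ∀ x : Module.End k (S i),
      ψ (LinearMap.single k (fun i => Module.End k (S i)) i x)
        = c * LinearMap.trace k (S i) x := by
    intro i
    refine aux_trace_unique (ψ ∘ₗ LinearMap.single k (fun i => Module.End k (S i)) i) ?_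
    intro x y
    have := hψc (Pi.single i x) (Pi.single i y)
    rw [← Pi.single_mul, ← Pi.single_mul] at this
    exact this
  choose c hc using hex
  refine ⟨c, fun x => ?_⟩
  have hm : ρ x = ∑ j, LinearMap.single k (fun i => Module.End k (S i)) j (ρ x j) := by
    simp [Finset.univ_sum_single]
  rw [← hψ, hm, map_sum]
  exact Finset.sum_congr rfl fun i _ => hc i _

/-- A projective cover of a simple module is `A e`. -/
theorem aux_cover {A : Type*} [Ring A] {P S : Type*} [AddCommGroup P] [Module A P]
    [AddCommGroup S] [Module A S] (hS : IsSimpleModule A S) (hP : Module.Projective A P)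
    (f : P →ₗ[A] S) (hf : Function.Surjective f)
    (hsmall : ∀ K : Submodule A P, LinearMap.ker f ⊔ K = ⊤ → K = ⊤) :
    ∃ (s : P →ₗ[A] A) (p : P), ∀ q, s q • p = q := by
  have : Nontrivial S := IsSimpleModule.nontrivial A S
  obtain ⟨y, hy⟩ := exists_ne (0 : S)
  obtain ⟨p, rfl⟩ := hf y
  have hco : IsCoatom (LinearMap.ker f) := LinearMap.isCoatom_ker_of_surjective hf
  have hp : Submodule.span A {p} = ⊤ := by
    apply hsmall
    apply hco.2
    refine lt_of_le_of_ne le_sup_left fun h => hy ?_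
    have : p ∈ LinearMap.ker f := by
      rw [h]
      exact Submodule.mem_sup_right (Submodule.mem_span_singleton_self p)
    exact this
  have hsu : Function.Surjective (LinearMap.toSpanSingleton A P p) := by
    rw [← LinearMap.range_eq_top, LinearMap.range_toSpanSingleton, hp]
  obtain ⟨s, hs⟩ := Module.projective_lifting_property _ LinearMap.id hsu
  exact ⟨s, p, fun q => congrArg (fun t => t q) hs⟩

theorem aux_ker {A : Type*} [Ring A] {P S U : Type*} [AddCommGroup P] [Module A P]
    [AddCommGroup S] [Module A S] [AddCommGroup U] [Module A U]
    (hS : IsSimpleModule A S) (hU : IsSimpleModule A U)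
    (f : P →ₗ[A] S) (hf : Function.Surjective f)
    (hsmall : ∀ K : Submodule A P, LinearMap.ker f ⊔ K = ⊤ → K = ⊤)
    (h : P →ₗ[A] U) (h0 : h ≠ 0) : LinearMap.ker f = LinearMap.ker h := by
  have hco : IsCoatom (LinearMap.ker f) := LinearMap.isCoatom_ker_of_surjective hf
  have hco' : IsCoatom (LinearMap.ker h) :=
    LinearMap.isCoatom_ker_of_surjective (LinearMap.surjective_of_ne_zero h0)
  by_contra hne
  exact hco'.1 (hsmall _ (hco.sup_eq_top_of_ne hco' hne))

theorem aux_factor {A : Type*} [Ring A] {P S U : Type*} [AddCommGroup P] [Module A P]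
    [AddCommGroup S] [Module A S] [AddCommGroup U] [Module A U]
    (f : P →ₗ[A] S) (hf : Function.Surjective f)
    (h : P →ₗ[A] U) (hk : LinearMap.ker f ≤ LinearMap.ker h) :
    ∃ g : S →ₗ[A] U, g ∘ₗ f = h := by
  refine ⟨(LinearMap.ker f).liftQ h hk ∘ₗ
      (f.quotKerEquivOfSurjective hf).symm.toLinearMap, ?_⟩
  ext a
  have : (f.quotKerEquivOfSurjective hf).symm (f a) = Submodule.Quotient.mk a := by
    rw [LinearEquiv.symm_apply_eq]
    rfl
  simp [this]

/-- Let `k` be an algebraically closed field of characteristic zero and `A` a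
finite-dimensional self-injective `k`-algebra.  Let `(S i)` be a complete set of
representatives of the isomorphism classes of simple left `A`-modules with projective covers
`(P i)`, and let `c i j = dim_k Hom_A(P i, P j)` be the Cartan matrix of `A`.  Then for all
`a, b ∈ A`, the trace of the `k`-linear map `A → A, x ↦ a x b` equals
`∑_{i,j} c i j ⬝ χ^A_{S i}(a) ⬝ χ^A_{S j}(b)`. -/
theorem trace_bimodule_eq_cartan_bilinear_characters
    (k : Type u) [Field k] [IsAlgClosed k] [CharZero k]
    (A : Type v) [Ring A] [Algebra k A] [FiniteDimensional k A]
    [Module.Injective A A]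
    (I : Type v) [Fintype I]
    (S : I → Type v) [∀ i, AddCommGroup (S i)] [∀ i, Module k (S i)] [∀ i, Module A (S i)]
    [∀ i, IsScalarTower k A (S i)] [∀ i, FiniteDimensional k (S i)]
    (hsimple : ∀ i, IsSimpleModule A (S i))
    (hdistinct : ∀ i i', Nonempty (S i ≃ₗ[A] S i') → i = i')
    (hcomplete : ∀ (U : Type v) [AddCommGroup U] [Module A U],
      IsSimpleModule A U → ∃ i, Nonempty (U ≃ₗ[A] S i))
    (P : I → Type v) [∀ i, AddCommGroup (P i)] [∀ i, Module k (P i)] [∀ i, Module A (P i)]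
    [∀ i, IsScalarTower k A (P i)] [∀ i, FiniteDimensional k (P i)]
    (hproj : ∀ i, Module.Projective A (P i))
    (f : ∀ i, P i →ₗ[A] S i) (hsurj : ∀ i, Function.Surjective (f i))
    (hsmall : ∀ i, ∀ K : Submodule A (P i), LinearMap.ker (f i) ⊔ K = ⊤ → K = ⊤)
    (a b : A) :
    LinearMap.trace k A ((LinearMap.mulLeft k a).comp (LinearMap.mulRight k b))
      = ∑ i, ∑ j, (Module.finrank k (P i →ₗ[A] P j) : k)
          * moduleChar k (S i) a * moduleChar k (S j) b := by
  classical
  have hcov := fun i => aux_cover (hsimple i) (hproj i) (f i) (hsurj i) (hsmall i)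
  choose s p hs using hcov
  -- the value of the simple characters at the idempotents `s i (p i)`
  have hchar : ∀ i j, moduleChar k (S j) (s i (p i)) = if i = j then 1 else 0 := by
    intro i j
    have hsi := hsimple i
    have hsj := hsimple j
    rw [aux_trace_hom (s i) (p i) (hs i)]
    split_ifs with hij
    · subst hij
      have : Nontrivial (S i) := IsSimpleModule.nontrivial A (S i)
      have hf0 : f i ≠ 0 := by
        intro h0
        obtain ⟨y, hy⟩ := exists_ne (0 : S i)
        obtain ⟨q, rfl⟩ := hsurj i y
        exact hy (by simp [h0])
      have : Module.finrank k (P i →ₗ[A] S i) = 1 := by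
        rw [finrank_eq_one_iff_of_nonzero' (f i) hf0]
        intro w
        by_cases hw : w = 0
        · exact ⟨0, by simp [hw]⟩
        obtain ⟨g, rfl⟩ := aux_factor (f i) (hsurj i) w
          (aux_ker hsi hsi (f i) (hsurj i) (hsmall i) w hw).le
        obtain ⟨c, rfl⟩ := (IsSimpleModule.algebraMap_end_bijective_of_isAlgClosed (A := A)
          (V := S i) k).2 g
        exact ⟨c, by ext; simp⟩
      simp [this]
    · have : ∀ w : P i →ₗ[A] S j, w = 0 := by
        intro w
        by_contra hw
        have hk := aux_ker hsi hsj (f i) (hsurj i) (hsmall i) w hw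
        obtain ⟨g, rfl⟩ := aux_factor (f i) (hsurj i) w hk.le
        have hg : g ≠ 0 := by
          rintro rfl
          exact hw (by simp)
        exact hij (hdistinct _ _ ⟨LinearEquiv.ofBijective g (LinearMap.bijective_of_ne_zero hg)⟩)
      have : Subsingleton (P i →ₗ[A] S j) := ⟨fun x y => by rw [this x, this y]⟩
      simp [Module.finrank_zero_of_subsingleton]
  have hclass : ∀ (φ : A →ₗ[k] k), (∀ x y, φ (x * y) = φ (y * x)) →
      (∀ x, IsNilpotent x → φ x = 0) →
      ∀ x, φ x = ∑ i, φ (s i (p i)) * moduleChar k (S i) x := by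
    intro φ h1 h2 x
    obtain ⟨c, hc⟩ := aux_class S hsimple hdistinct hcomplete φ h1 h2
    rw [hc x]
    refine Finset.sum_congr rfl fun i _ => ?_
    rw [hc (s i (p i))]
    simp [hchar]
  let T : A → A → k := fun a b =>
    LinearMap.trace k A ((LinearMap.mulLeft k a).comp (LinearMap.mulRight k b))
  have hcomm : ∀ a b : A, Commute (LinearMap.mulLeft k a) (LinearMap.mulRight k b) :=
    fun a b => LinearMap.commute_mulLeft_right (R := k) (A := A) a b
  have hLmul : ∀ a b : A, LinearMap.mulLeft k (a * b)
      = LinearMap.mulLeft k a * LinearMap.mulLeft k b := fun a b => by ext z; simp [mul_assoc]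
  have hRmul : ∀ a b : A, LinearMap.mulRight k (a * b)
      = LinearMap.mulRight k b * LinearMap.mulRight k a := fun a b => by ext z; simp [mul_assoc]
  have hLnil : ∀ x : A, IsNilpotent x → IsNilpotent (LinearMap.mulLeft k x) := by
    rintro x ⟨n, hn⟩
    exact ⟨n, by rw [LinearMap.pow_mulLeft, hn]; simp⟩
  have hRnil : ∀ x : A, IsNilpotent x → IsNilpotent (LinearMap.mulRight k x) := by
    rintro x ⟨n, hn⟩
    exact ⟨n, by rw [LinearMap.pow_mulRight, hn]; simp⟩
  have hT1 : ∀ a b, T a b = ∑ i, T (s i (p i)) b * moduleChar k (S i) a := by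
    intro a b
    let φ : A →ₗ[k] k :=
      { toFun := fun a => T a b
        map_add' := fun x y => by
          simp only [T]
          rw [← map_add]
          congr 1
          ext z
          simp [add_mul]
        map_smul' := fun c x => by
          simp only [T, RingHom.id_apply]
          rw [← map_smul]
          congr 1
          ext z
          simp }
    refine hclass φ ?_ ?_ a
    · intro x y
      change LinearMap.trace k A (LinearMap.mulLeft k (x * y) * LinearMap.mulRight k b)
        = LinearMap.trace k A (LinearMap.mulLeft k (y * x) * LinearMap.mulRight k b)
      rw [hLmul, hLmul, mul_assoc, LinearMap.trace_mul_comm, mul_assoc, ← (hcomm x b).eq,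
        mul_assoc]
    · intro x hx
      exact (LinearMap.isNilpotent_trace_of_isNilpotent
        ((hcomm x b).isNilpotent_mul_right (hLnil x hx))).eq_zero
  have hT2 : ∀ a b, T a b = ∑ j, T a (s j (p j)) * moduleChar k (S j) b := by
    intro a b
    let φ : A →ₗ[k] k :=
      { toFun := fun b => T a b
        map_add' := fun x y => by
          simp only [T]
          rw [← map_add]
          congr 1
          ext z
          simp [mul_add]
        map_smul' := fun c x => by
          simp only [T, RingHom.id_apply]
          rw [← map_smul]
          congr 1
          ext z
          simp }
    refine hclass φ ?_ ?_ b
    · intro x y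
      change LinearMap.trace k A (LinearMap.mulLeft k a * LinearMap.mulRight k (x * y))
        = LinearMap.trace k A (LinearMap.mulLeft k a * LinearMap.mulRight k (y * x))
      rw [hRmul, hRmul, ← mul_assoc, LinearMap.trace_mul_comm, ← mul_assoc, ← (hcomm a x).eq,
        mul_assoc]
    · intro x hx
      exact (LinearMap.isNilpotent_trace_of_isNilpotent
        ((hcomm a x).isNilpotent_mul_left (hRnil x hx))).eq_zero
  have hTe : ∀ i j, T (s i (p i)) (s j (p j)) = (Module.finrank k (P i →ₗ[A] P j) : k) := by
    intro i j
    rw [← aux_trace_hom (s i) (p i) (hs i)]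
    let u : A →ₗ[k] P j := (LinearMap.toSpanSingleton A (P j) (p j)).restrictScalars k
    let w : P j →ₗ[k] A := (s j).restrictScalars k
    have h1 : (LinearMap.mulLeft k (s i (p i))).comp (LinearMap.mulRight k (s j (p j)))
        = (LinearMap.mulLeft k (s i (p i)) ∘ₗ w) ∘ₗ u := by
      ext x
      simp [u, w]
    have h2 : DistribMulAction.toLinearMap k (P j) (s i (p i))
        = u ∘ₗ (LinearMap.mulLeft k (s i (p i)) ∘ₗ w) := by
      ext x
      change s i (p i) • x = (s i (p i) * s j x) • p j
      rw [mul_smul, hs]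
    simp only [T, moduleChar]
    rw [h1, h2, LinearMap.trace_comp_comm']
  change T a b = _
  rw [hT1]
  refine Finset.sum_congr rfl fun i _ => ?_
  rw [hT2, Finset.sum_mul]
  refine Finset.sum_congr rfl fun j _ => ?_
  rw [hTe]
  ring
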